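/- Let g : {1,…,10} → ℕ be g = (2,2,1,1,1,1,1,1,1,1) and let P be the set of vectors v : {1,…,10} → ℕ with v ≤ g pointwise such that v(1) ≥ 2, or (v(1) ≥ 1 and v(j) ≥ 1 for some j ∈ {2,…,10}), or v(2) ≥ 2, or (v(2) ≥ 1 and v(3) ≥ 1) (i.e., the exponent vectors ≤ g of monomials in L₂ = (x₁², x₁x₂, …, x₁x₁₀, x₂², x₂x₃) ⊂ K[x₁,…,x₁₀]). Then there is no finite family of pairs (b_j, c_j) with b_j ≤ c_j pointwise, b_j ∈ P, c_j ∈ P and #{i : c_j(i) = g(i)} ≥ 6 for all j, such that the intervals {w : b_j ≤ w ≤ c_j pointwise} are pairwise disjoint and their union is all of P. (By the Herzog–Vladoiu–Zheng criterion this says sdepth(L₂) ≤ 5, so sdepth(L₂) = 5 < hdepth(L₂) = 6, disproving the first identity of Shen's Conjecture 4.3; Counterexample 3.3.) -/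

import Mathlib

/-- The bound vector `g = (2,2,1,1,1,1,1,1,1,1)` for Counterexample 3.3. -/
def stmt17g : Fin 10 → ℕ := ![2, 2, 1, 1, 1, 1, 1, 1, 1, 1]

/-- Membership of an exponent vector `v` in the lex ideal
`L₂ = (x₁², x₁x₂, …, x₁x₁₀, x₂², x₂x₃) ⊂ K[x₁,…,x₁₀]` (zero-indexed variables). -/
def stmt17Mem (v : Fin 10 → ℕ) : Prop :=
  2 ≤ v 0 ∨ (1 ≤ v 0 ∧ ∃ j : Fin 10, j ≠ 0 ∧ 1 ≤ v j) ∨ 2 ≤ v 1 ∨ (1 ≤ v 1 ∧ 1 ≤ v 2)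

/-- The poset `P` of exponent vectors `v ≤ g` of monomials of `L₂`. -/
def stmt17P (v : Fin 10 → ℕ) : Prop := v ≤ stmt17g ∧ stmt17Mem v

/-- The exponent vector of `x₁ ^ a * x₂ ^ d * x^s`, with `s` the exponents of `x₃, …, x₁₀`. -/
def lowVec (a d : ℕ) (s : Fin 8 → ℕ) : Fin 10 → ℕ := Fin.cons a (Fin.cons d s)

/-- A dual certificate: an integer weighting of the low degree elements of `P`, viewed as a linear
functional on functions of exponent vectors. It is nonpositive on the indicator of every admissible
interval, but positive on the indicator of `P`. -/
def lowWeight : ((Fin 10 → ℕ) → ℤ) →ₗ[ℤ] ℤ :=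
  let ev (a d : ℕ) (s : Fin 8 → ℕ) : ((Fin 10 → ℕ) → ℤ) →ₗ[ℤ] ℤ := LinearMap.proj (lowVec a d s)
  (10 : ℤ) • ev 2 0 0 + (6 : ℤ) • ev 1 1 0 + (4 : ℤ) • ev 1 2 0 - ev 2 1 0 - ev 2 2 0
    + (10 : ℤ) • ∑ j, ev 1 0 (Pi.single j 1) - ∑ j, ev 1 1 (Pi.single j 1)
    - ∑ j, ev 1 2 (Pi.single j 1) - (2 : ℤ) • ∑ j, ev 2 0 (Pi.single j 1)
    - ∑ j, ∑ k ∈ Finset.univ.erase j, ev 1 0 (Pi.single j 1 + Pi.single k 1)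

theorem lowWeight_apply (f : (Fin 10 → ℕ) → ℤ) :
    lowWeight f = 10 * f (lowVec 2 0 0) + 6 * f (lowVec 1 1 0) + 4 * f (lowVec 1 2 0)
      - f (lowVec 2 1 0) - f (lowVec 2 2 0)
      + 10 * ∑ j, f (lowVec 1 0 (Pi.single j 1)) - ∑ j, f (lowVec 1 1 (Pi.single j 1))
      - ∑ j, f (lowVec 1 2 (Pi.single j 1)) - 2 * ∑ j, f (lowVec 2 0 (Pi.single j 1))
      - ∑ j, ∑ k ∈ Finset.univ.erase j, f (lowVec 1 0 (Pi.single j 1 + Pi.single k 1)) := by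
  simp [lowWeight]

/-- The indicator function of the interval `[b, c]`. -/
noncomputable def intervalInd (b c : Fin 10 → ℕ) : (Fin 10 → ℕ) → ℤ :=
  (Set.Icc b c).indicator 1

theorem intervalInd_nonneg (b c v : Fin 10 → ℕ) : 0 ≤ intervalInd b c v :=
  Set.indicator_nonneg (fun _ _ => zero_le_one) v

theorem intervalInd_of_not_le {b c v : Fin 10 → ℕ} (h : ¬ b ≤ v) : intervalInd b c v = 0 :=
  Set.indicator_of_notMem (fun hv => h hv.1) _

theorem le_lowVec_iff {v : Fin 10 → ℕ} {a d : ℕ} {s : Fin 8 → ℕ} :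
    v ≤ lowVec a d s ↔ v 0 ≤ a ∧ v 1 ≤ d ∧ ∀ j : Fin 8, v j.succ.succ ≤ s j := by
  simp only [Pi.le_def, Fin.forall_fin_succ (n := 9), Fin.forall_fin_succ (n := 8)]
  rfl

theorem lowVec_le_iff {v : Fin 10 → ℕ} {a d : ℕ} {s : Fin 8 → ℕ} :
    lowVec a d s ≤ v ↔ a ≤ v 0 ∧ d ≤ v 1 ∧ ∀ j : Fin 8, s j ≤ v j.succ.succ := by
  simp only [Pi.le_def, Fin.forall_fin_succ (n := 9), Fin.forall_fin_succ (n := 8)]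
  rfl

theorem intervalInd_lowVec (a d a' d' : ℕ) (s s' : Fin 8 → ℕ) (c : Fin 10 → ℕ) :
    intervalInd (lowVec a d s) c (lowVec a' d' s') =
      if (a ≤ a' ∧ d ≤ d' ∧ ∀ j, s j ≤ s' j) ∧
        (a' ≤ c 0 ∧ d' ≤ c 1 ∧ ∀ j : Fin 8, s' j ≤ c j.succ.succ) then 1 else 0 := by
  classical
  simp only [intervalInd, Set.indicator_apply, Set.mem_Icc, le_lowVec_iff, lowVec_le_iff,
    Pi.one_apply]
  rfl

theorem eq_lowVec {v : Fin 10 → ℕ} {a d : ℕ} {s : Fin 8 → ℕ} (h0 : v 0 = a) (h1 : v 1 = d)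
    (h : ∀ j : Fin 8, v j.succ.succ = s j) : v = lowVec a d s :=
  le_antisymm (le_lowVec_iff.2 ⟨h0.le, h1.le, fun j => (h j).le⟩)
    (lowVec_le_iff.2 ⟨h0.ge, h1.ge, fun j => (h j).ge⟩)

theorem stmt17P_iff {v : Fin 10 → ℕ} :
    stmt17P v ↔ (v 0 ≤ 2 ∧ v 1 ≤ 2 ∧ ∀ j : Fin 8, v j.succ.succ ≤ 1) ∧
      (2 ≤ v 0 ∨ (1 ≤ v 0 ∧ (1 ≤ v 1 ∨ ∃ j : Fin 8, 1 ≤ v j.succ.succ)) ∨ 2 ≤ v 1 ∨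
        (1 ≤ v 1 ∧ 1 ≤ v 2)) := by
  have hg : stmt17g = lowVec 2 2 1 := by decide
  rw [stmt17P, stmt17Mem, hg, le_lowVec_iff, Fin.exists_fin_succ, Fin.exists_fin_succ]
  simp

/-- For `c ≤ g`, the number of coordinates where `c` is maximal, as a sum. -/
theorem card_filter_eq_stmt17g {c : Fin 10 → ℕ} (hc : stmt17P c) :
    (Finset.univ.filter (fun i => c i = stmt17g i)).card =
      (c 0 - 1) + (c 1 - 1) + ∑ j : Fin 8, c j.succ.succ := by
  obtain ⟨⟨h0, h1, h⟩, -⟩ := stmt17P_iff.1 hc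
  rw [Finset.card_filter, Fin.sum_univ_succ, Fin.sum_univ_succ, ← add_assoc]
  congr 1
  · congr 1
    · change (if c 0 = 2 then 1 else 0) = c 0 - 1
      split_ifs <;> omega
    · change (if c 1 = 2 then 1 else 0) = c 1 - 1
      split_ifs <;> omega
  · refine Finset.sum_congr rfl fun j _ => ?_
    have hj : stmt17g j.succ.succ = 1 := by fin_cases j <;> rfl
    have := h j
    rw [hj]
    split_ifs <;> omega

theorem ite_one_le_eq {n : ℕ} (h : n ≤ 1) : (if 1 ≤ n then (1 : ℤ) else 0) = n := by
  split_ifs <;> omega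

theorem forall_single_le_iff {s : Fin 8 → ℕ} {j : Fin 8} :
    (∀ i, (Pi.single j 1 : Fin 8 → ℕ) i ≤ s i) ↔ 1 ≤ s j := by
  refine ⟨fun h => by simpa using h j, fun h i => ?_⟩
  rcases eq_or_ne i j with rfl | hi <;> simp [*]

theorem forall_single_add_single_le_iff {s : Fin 8 → ℕ} {j k : Fin 8} (hjk : k ≠ j) :
    (∀ i, (Pi.single j 1 + Pi.single k 1 : Fin 8 → ℕ) i ≤ s i) ↔ 1 ≤ s j ∧ 1 ≤ s k := by
  refine ⟨fun h => ⟨by simpa [hjk.symm] using h j, by simpa [hjk] using h k⟩, fun h i => ?_⟩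
  rcases eq_or_ne i j with rfl | hj
  · simpa [hjk.symm] using h.1
  rcases eq_or_ne i k with rfl | hk
  · simpa [hj] using h.2
  · simp [hj, hk]

/-- In an off-diagonal sum of a nonnegative symmetric function, a row and the corresponding column
contribute twice the row sum. -/
theorem two_mul_sum_erase_le {ι : Type*} [Fintype ι] [DecidableEq ι] {f : ι → ι → ℤ}
    (hf : ∀ j k, 0 ≤ f j k) (hsymm : ∀ j k, f j k = f k j) (j : ι) :
    2 * ∑ k ∈ Finset.univ.erase j, f j k ≤ ∑ i, ∑ k ∈ Finset.univ.erase i, f i k := by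
  rw [← Finset.add_sum_erase _ _ (Finset.mem_univ j), two_mul]
  gcongr with i hi
  rw [hsymm j i]
  exact Finset.single_le_sum (f := f i) (fun k _ => hf i k)
    (Finset.mem_erase.2 ⟨(Finset.ne_of_mem_erase hi).symm, Finset.mem_univ j⟩)

section Interval

variable {c : Fin 10 → ℕ}

theorem sum_intervalInd_lowVec_zero (hc : stmt17P c) (a d a' d' : ℕ) :
    ∑ j, intervalInd (lowVec a d 0) c (lowVec a' d' (Pi.single j 1)) =
      if (a ≤ a' ∧ d ≤ d') ∧ a' ≤ c 0 ∧ d' ≤ c 1 then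
        ((∑ j : Fin 8, c j.succ.succ : ℕ) : ℤ) else 0 := by
  split_ifs with h
  · push_cast
    refine Finset.sum_congr rfl fun j _ => ?_
    simp [intervalInd_lowVec, forall_single_le_iff, h,
      ite_one_le_eq ((stmt17P_iff.1 hc).1.2.2 j)]
  · refine Finset.sum_eq_zero fun j _ => ?_
    rw [intervalInd_lowVec, if_neg]
    tauto

theorem sum_intervalInd_lowVec_single {j : Fin 8} (hj : 1 ≤ c j.succ.succ) (a d a' d' : ℕ) :
    ∑ k, intervalInd (lowVec a d (Pi.single j 1)) c (lowVec a' d' (Pi.single k 1)) =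
      if (a ≤ a' ∧ d ≤ d') ∧ a' ≤ c 0 ∧ d' ≤ c 1 then 1 else 0 := by
  rw [Finset.sum_eq_single j]
  · simp [intervalInd_lowVec, forall_single_le_iff (s := fun i => c i.succ.succ), hj, and_assoc]
  · intro k _ hk
    rw [intervalInd_lowVec, if_neg]
    rintro ⟨⟨-, -, h⟩, -⟩
    simpa [hk.symm] using h j
  · simp

theorem lowWeight_nonpos_of_zero (hc : stmt17P c)
    (hcard : 6 ≤ (c 0 - 1) + (c 1 - 1) + ∑ j : Fin 8, c j.succ.succ) {a d : ℕ}
    (ha : a ≤ c 0) (hd : d ≤ c 1)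
    (had : (a = 2 ∧ d = 0) ∨ (a = 1 ∧ d = 1) ∨ (a = 1 ∧ d = 2) ∨ (a = 0 ∧ d = 2)) :
    lowWeight (intervalInd (lowVec a d 0) c) ≤ 0 := by
  obtain ⟨⟨h0, h1, -⟩, -⟩ := stmt17P_iff.1 hc
  have hp : 0 ≤ ∑ j, ∑ k ∈ Finset.univ.erase j,
      intervalInd (lowVec a d 0) c (lowVec 1 0 (Pi.single j 1 + Pi.single k 1)) :=
    Finset.sum_nonneg fun _ _ => Finset.sum_nonneg fun _ _ => intervalInd_nonneg _ _ _
  rw [lowWeight_apply]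
  generalize ∑ j, ∑ k ∈ Finset.univ.erase j,
    intervalInd (lowVec a d 0) c (lowVec 1 0 (Pi.single j 1 + Pi.single k 1)) = m at *
  simp only [sum_intervalInd_lowVec_zero hc]
  generalize ∑ j : Fin 8, c j.succ.succ = n at *
  simp only [intervalInd_lowVec, le_refl, Pi.zero_apply, zero_le, implies_true, and_true]
  rcases had with ⟨rfl, rfl⟩ | ⟨rfl, rfl⟩ | ⟨rfl, rfl⟩ | ⟨rfl, rfl⟩ <;> norm_num <;>
    split_ifs <;> omega

theorem lowWeight_nonpos_of_single (hc : stmt17P c)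
    (hcard : 6 ≤ (c 0 - 1) + (c 1 - 1) + ∑ j : Fin 8, c j.succ.succ) {j : Fin 8}
    (h0 : 1 ≤ c 0) (hj : 1 ≤ c j.succ.succ) :
    lowWeight (intervalInd (lowVec 1 0 (Pi.single j 1)) c) ≤ 0 := by
  obtain ⟨⟨h0', h1, h⟩, -⟩ := stmt17P_iff.1 hc
  have hp := two_mul_sum_erase_le (j := j)
    (f := fun i k => intervalInd (lowVec 1 0 (Pi.single j 1)) c
      (lowVec 1 0 (Pi.single i 1 + Pi.single k 1)))
    (fun _ _ => intervalInd_nonneg _ _ _) (fun i k => by rw [add_comm])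
  have hrow : ∑ k ∈ Finset.univ.erase j, intervalInd (lowVec 1 0 (Pi.single j 1)) c
      (lowVec 1 0 (Pi.single j 1 + Pi.single k 1)) =
        ∑ k ∈ Finset.univ.erase j, (c k.succ.succ : ℤ) := by
    refine Finset.sum_congr rfl fun k hk => ?_
    have hjk : ∀ i, (Pi.single j 1 : Fin 8 → ℕ) i ≤
        (Pi.single j 1 + Pi.single k 1 : Fin 8 → ℕ) i :=
      fun i => Nat.le_add_right _ _
    simp [intervalInd_lowVec, forall_single_add_single_le_iff (s := fun i => c i.succ.succ)
      (Finset.ne_of_mem_erase hk), h0, hj, hjk, ite_one_le_eq (h k), -Pi.add_apply]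
  have hsum := Finset.add_sum_erase Finset.univ (fun k : Fin 8 => (c k.succ.succ : ℤ))
    (Finset.mem_univ j)
  have hz : ∀ a d, intervalInd (lowVec 1 0 (Pi.single j 1)) c (lowVec a d 0) = 0 := by
    intro a d
    rw [intervalInd_lowVec, if_neg]
    rintro ⟨⟨-, -, h⟩, -⟩
    simpa using h j
  have hj' := h j
  rw [lowWeight_apply]
  simp only [sum_intervalInd_lowVec_single hj, hz]
  simp only [hrow] at hp
  generalize ∑ i, ∑ k ∈ Finset.univ.erase i, intervalInd (lowVec 1 0 (Pi.single j 1)) c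
    (lowVec 1 0 (Pi.single i 1 + Pi.single k 1)) = m at *
  zify at hcard
  generalize ∑ j : Fin 8, (c j.succ.succ : ℤ) = n at *
  norm_num [h0]
  split_ifs <;> omega

theorem eq_of_le_lowVec_single {b : Fin 10 → ℕ} (hb : stmt17P b) {j : Fin 8}
    (h : b ≤ lowVec 1 0 (Pi.single j 1)) : b = lowVec 1 0 (Pi.single j 1) := by
  obtain ⟨-, hm⟩ := stmt17P_iff.1 hb
  obtain ⟨h0, h1, ht⟩ := le_lowVec_iff.1 h
  have hm' : 1 ≤ b 0 ∧ ∃ i : Fin 8, 1 ≤ b i.succ.succ := by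
    rcases hm with hm | ⟨hm, hm' | hm'⟩ | hm | hm
    · omega
    · omega
    · exact ⟨hm, hm'⟩
    · omega
    · omega
  obtain ⟨h0', i, hi⟩ := hm'
  have hij : i = j := by
    by_contra hij
    have := ht i
    rw [Pi.single_eq_of_ne hij] at this
    omega
  subst hij
  exact h.antisymm (lowVec_le_iff.2 ⟨h0', Nat.zero_le _,
    (forall_single_le_iff (s := fun i => b i.succ.succ)).2 hi⟩)

theorem eq_lowVec_zero_of_le {b : Fin 10 → ℕ} (hb : stmt17P b)
    (h : b ≤ lowVec 2 0 0 ∨ b ≤ lowVec 1 2 0) :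
    ∃ a d, ((a = 2 ∧ d = 0) ∨ (a = 1 ∧ d = 1) ∨ (a = 1 ∧ d = 2) ∨ (a = 0 ∧ d = 2)) ∧
      b = lowVec a d 0 := by
  obtain ⟨-, hm⟩ := stmt17P_iff.1 hb
  simp only [le_lowVec_iff, Pi.zero_apply, nonpos_iff_eq_zero] at h
  have ht : ∀ j : Fin 8, b j.succ.succ = 0 := h.elim (fun h => h.2.2) (fun h => h.2.2)
  have h2 : b 2 = 0 := ht 0
  have hm' : ¬ ∃ j : Fin 8, 1 ≤ b j.succ.succ := by simp [ht]
  simp only [ht, implies_true, and_true] at h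
  refine ⟨b 0, b 1, ?_, eq_lowVec rfl rfl ht⟩
  simp only [hm', or_false] at hm
  omega

/-- The weight of every admissible interval is nonpositive. -/
theorem lowWeight_intervalInd_nonpos {b c : Fin 10 → ℕ} (hbc : b ≤ c) (hb : stmt17P b)
    (hc : stmt17P c) (hcard : 6 ≤ (Finset.univ.filter (fun i => c i = stmt17g i)).card) :
    lowWeight (intervalInd b c) ≤ 0 := by
  rw [card_filter_eq_stmt17g hc] at hcard
  by_cases hs : ∃ j : Fin 8, b ≤ lowVec 1 0 (Pi.single j 1)
  · obtain ⟨j, hj⟩ := hs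
    obtain rfl := eq_of_le_lowVec_single hb hj
    obtain ⟨h0, -, ht⟩ := lowVec_le_iff.1 hbc
    exact lowWeight_nonpos_of_single hc hcard h0
      ((forall_single_le_iff (s := fun i => c i.succ.succ)).1 ht)
  by_cases hz : b ≤ lowVec 2 0 0 ∨ b ≤ lowVec 1 2 0
  · obtain ⟨a, d, had, rfl⟩ := eq_lowVec_zero_of_le hb hz
    exact lowWeight_nonpos_of_zero hc hcard (hbc 0) (hbc 1) had
  push Not at hs hz
  have h11 : ¬ b ≤ lowVec 1 1 0 := fun h =>
    hz.2 (h.trans (le_lowVec_iff.2 ⟨le_rfl, one_le_two, fun _ => le_rfl⟩))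
  rw [lowWeight_apply, intervalInd_of_not_le hz.1, intervalInd_of_not_le hz.2,
    intervalInd_of_not_le h11, Finset.sum_eq_zero fun j _ => intervalInd_of_not_le (hs j)]
  have hn := intervalInd_nonneg b c
  have hsum : ∀ a d, 0 ≤ ∑ j, intervalInd b c (lowVec a d (Pi.single j 1)) :=
    fun a d => Finset.sum_nonneg fun _ _ => hn _
  have hp : 0 ≤ ∑ j, ∑ k ∈ Finset.univ.erase j,
      intervalInd b c (lowVec 1 0 (Pi.single j 1 + Pi.single k 1)) :=
    Finset.sum_nonneg fun _ _ => Finset.sum_nonneg fun _ _ => hn _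
  linarith [hn (lowVec 2 1 0), hn (lowVec 2 2 0), hsum 1 1, hsum 1 2, hsum 2 0]

end Interval

theorem stmt17P_lowVec {a d : ℕ} {s : Fin 8 → ℕ} (ha : 1 ≤ a) (ha' : a ≤ 2) (hd : d ≤ 2)
    (hs : ∀ j, s j ≤ 1) (h : 2 ≤ a ∨ 1 ≤ d ∨ ∃ j, 1 ≤ s j) : stmt17P (lowVec a d s) :=
  stmt17P_iff.2 ⟨⟨ha', hd, hs⟩, h.imp_right fun h => Or.inl ⟨ha, h⟩⟩

/-- The weight of `P` is positive. -/
theorem lowWeight_indicator_stmt17P : lowWeight ({v | stmt17P v}.indicator 1) = 10 := by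
  have hone : ∀ v, stmt17P v → ({v | stmt17P v}.indicator 1 : _ → ℤ) v = 1 :=
    fun v hv => Set.indicator_of_mem (s := {v | stmt17P v}) hv 1
  have hsingle : ∀ a d, 1 ≤ a → a ≤ 2 → d ≤ 2 → ∀ j : Fin 8,
      ({v | stmt17P v}.indicator 1 : _ → ℤ) (lowVec a d (Pi.single j 1)) = 1 := by
    intro a d ha ha' hd j
    refine hone _ (stmt17P_lowVec ha ha' hd ?_ (Or.inr (Or.inr ⟨j, by simp⟩)))
    exact (forall_single_le_iff (s := 1)).2 le_rfl
  have hpair : ∀ j : Fin 8, ∑ k ∈ Finset.univ.erase j, ({v | stmt17P v}.indicator 1 : _ → ℤ)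
      (lowVec 1 0 (Pi.single j 1 + Pi.single k 1)) = 7 := by
    intro j
    rw [Finset.sum_congr rfl fun k hk => hone _ (stmt17P_lowVec le_rfl one_le_two (Nat.zero_le _)
      ((forall_single_add_single_le_iff (s := 1) (Finset.ne_of_mem_erase hk)).2
        ⟨le_rfl, le_rfl⟩) (Or.inr (Or.inr ⟨j, by simp⟩)))]
    simp
  rw [lowWeight_apply]
  simp only [hpair, hsingle 1 0 le_rfl one_le_two (Nat.zero_le 2),
    hsingle 1 1 le_rfl one_le_two one_le_two,
    hsingle 1 2 le_rfl one_le_two le_rfl, hsingle 2 0 one_le_two le_rfl (Nat.zero_le 2)]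
  rw [hone _ (stmt17P_lowVec (by simp) (by simp) (by simp) (by simp) (by simp)),
    hone _ (stmt17P_lowVec (by simp) (by simp) (by simp) (by simp) (by simp)),
    hone _ (stmt17P_lowVec (by simp) (by simp) (by simp) (by simp) (by simp)),
    hone _ (stmt17P_lowVec (by simp) (by simp) (by simp) (by simp) (by simp)),
    hone _ (stmt17P_lowVec (by simp) (by simp) (by simp) (by simp) (by simp))]
  simp

/-- Counterexample 3.3: the poset `P = P_{L₂}^g` admits no partition into intervals
`[b_j, c_j]` with `b_j, c_j ∈ P` and `#{i : c_j(i) = g(i)} ≥ 6`; by the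
Herzog–Vladoiu–Zheng criterion this says `sdepth(L₂) ≤ 5`, so
`sdepth(L₂) = 5 < hdepth(L₂) = 6`, disproving the first identity of Shen's
Conjecture 4.3. -/
theorem stmt_17 :
    ¬ ∃ Part : Finset ((Fin 10 → ℕ) × (Fin 10 → ℕ)),
      (∀ p ∈ Part, p.1 ≤ p.2 ∧ stmt17P p.1 ∧ stmt17P p.2 ∧
        6 ≤ (Finset.univ.filter (fun i => p.2 i = stmt17g i)).card) ∧
      (∀ p ∈ Part, ∀ q ∈ Part, p ≠ q →
        ∀ w : Fin 10 → ℕ, ¬((p.1 ≤ w ∧ w ≤ p.2) ∧ (q.1 ≤ w ∧ w ≤ q.2))) ∧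
      (∀ v : Fin 10 → ℕ, stmt17P v ↔ ∃ p ∈ Part, p.1 ≤ v ∧ v ≤ p.2) := by
  rintro ⟨Part, hPart, hdisj, hcover⟩
  have hsum : ∑ p ∈ Part, intervalInd p.1 p.2 = {v | stmt17P v}.indicator 1 := by
    funext v
    rw [Finset.sum_apply]
    by_cases hv : stmt17P v
    · obtain ⟨p, hp, hpv⟩ := (hcover v).1 hv
      rw [Set.indicator_of_mem (s := {v | stmt17P v}) hv, Finset.sum_eq_single_of_mem p hp]
      · exact Set.indicator_of_mem (s := Set.Icc p.1 p.2) hpv 1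
      · intro q hq hqp
        exact Set.indicator_of_notMem (s := Set.Icc q.1 q.2)
          (fun hqv => hdisj q hq p hp hqp v ⟨hqv, hpv⟩) 1
    · rw [Set.indicator_of_notMem (s := {v | stmt17P v}) hv]
      exact Finset.sum_eq_zero fun p hp => Set.indicator_of_notMem (s := Set.Icc p.1 p.2)
        (fun hpv => hv ((hcover v).2 ⟨p, hp, hpv⟩)) 1
  have hle : lowWeight (∑ p ∈ Part, intervalInd p.1 p.2) ≤ 0 := by
    rw [map_sum]
    refine Finset.sum_nonpos fun p hp => ?_
    obtain ⟨hbc, hb, hc, hcard⟩ := hPart p hp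
    exact lowWeight_intervalInd_nonpos hbc hb hc hcard
  rw [hsum, lowWeight_indicator_stmt17P] at hle
  norm_num at hle
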